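/- Normal-refutation completeness of the Data Calculus DC: for every unsatisfiable datum α there exists a normal refutation of α in DC, i.e. a purely analytic DC-deduction of the empty datum ⊥ from α; moreover such a refutation exists that uses only analytic G-rules and the rule NC (in particular, without any use of the analytic S-rule Del). -/

import Mathlib

/-- Formulas of classical propositional logic: propositional variables,
negation, conjunction, disjunction. -/
inductive Fml : Type
  | var : ℕ → Fml
  | neg : Fml → Fml
  | conj : Fml → Fml → Fml
  | disj : Fml → Fml → Fml
  deriving DecidableEq

/-- A datum: a finite set of finite sets (components) of formulas. -/
abbrev Datum := Finset (Finset Fml)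

/-- Truth-value of a formula under an interpretation of the variables. -/
def Fml.eval (v : ℕ → Bool) : Fml → Bool
  | .var n => v n
  | .neg A => !A.eval v
  | .conj A B => A.eval v && B.eval v
  | .disj A B => A.eval v || B.eval v

/-- An interpretation verifies a datum iff some component has all its
formulas true. -/
def Verifies (v : ℕ → Bool) (α : Datum) : Prop :=
  ∃ Γ ∈ α, ∀ A ∈ Γ, A.eval v = true

/-- The analytic G-rules of the Data Calculus DC. -/
inductive GStep : Datum → Datum → Prop
  | conj (Γ : Finset Fml) (A B : Fml) (ρ : Datum) :
      GStep (insert (insert (Fml.conj A B) Γ) ρ)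
            (insert (insert A (insert B Γ)) ρ)
  | disj (Γ : Finset Fml) (A B : Fml) (ρ : Datum) :
      GStep (insert (insert (Fml.disj A B) Γ) ρ)
            (insert (insert A Γ) (insert (insert B Γ) ρ))
  | negneg (Γ : Finset Fml) (A : Fml) (ρ : Datum) :
      GStep (insert (insert (Fml.neg (Fml.neg A)) Γ) ρ)
            (insert (insert A Γ) ρ)
  | negdisj (Γ : Finset Fml) (A B : Fml) (ρ : Datum) :
      GStep (insert (insert (Fml.neg (Fml.disj A B)) Γ) ρ)
            (insert (insert (Fml.neg A) (insert (Fml.neg B) Γ)) ρ)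
  | negconj (Γ : Finset Fml) (A B : Fml) (ρ : Datum) :
      GStep (insert (insert (Fml.neg (Fml.conj A B)) Γ) ρ)
            (insert (insert (Fml.neg A) Γ) (insert (insert (Fml.neg B) Γ) ρ))

/-- The analytic N-rule NC: delete a component containing a pair A, ¬A. -/
def NCStep (α β : Datum) : Prop :=
  ∃ (Γ : Finset Fml) (A : Fml),
    α = insert (insert A (insert (Fml.neg A) Γ)) β

/-- The synthetic N-rule EM: replace a component Γ by the two components
Γ∪{A} and Γ∪{¬A}. -/
def EMStep (α β : Datum) : Prop :=
  ∃ (Γ : Finset Fml) (A : Fml) (ρ : Datum),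
    α = insert Γ ρ ∧
    β = insert (insert A Γ) (insert (insert (Fml.neg A) Γ) ρ)

/-- The analytic S-rule Del: replace a component Γ∪Δ by its subset Γ. -/
def DelStep (α β : Datum) : Prop :=
  ∃ (Γ Δ : Finset Fml) (ρ : Datum),
    α = insert (Γ ∪ Δ) ρ ∧ β = insert Γ ρ

/-- The synthetic S-rule Exp: add an arbitrary new component. -/
def ExpStep (α β : Datum) : Prop :=
  ∃ Γ : Finset Fml, β = insert Γ α

def Fml.wt : Bool → Fml → ℕ
  | _, .var _ => 1
  | b, .neg A => Fml.wt (!b) A + 1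
  | b, .conj A B => Fml.wt b A + Fml.wt b B + 3
  | b, .disj A B => Fml.wt b A + Fml.wt b B + 3

def compWt (Γ : Finset Fml) : ℕ := ∑ A ∈ Γ, Fml.wt true A

theorem compWt_insert_le (A : Fml) (Γ : Finset Fml) :
    compWt (insert A Γ) ≤ Fml.wt true A + compWt Γ := by
  unfold compWt
  by_cases h : A ∈ Γ
  · rw [Finset.insert_eq_of_mem h]; omega
  · rw [Finset.sum_insert h]

theorem compWt_erase (A : Fml) (Γ : Finset Fml) (h : A ∈ Γ) :
    Fml.wt true A + compWt (Γ.erase A) = compWt Γ := by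
  unfold compWt
  exact Finset.add_sum_erase Γ _ h

def Red : Fml → Prop
  | .var _ => False
  | .neg (.var _) => False
  | _ => True

theorem comp_elim (n : ℕ) : ∀ (Γ : Finset Fml), compWt Γ < n →
    (¬ ∃ v : ℕ → Bool, ∀ A ∈ Γ, A.eval v = true) → ∀ ρ : Datum,
    Relation.ReflTransGen (fun x y => GStep x y ∨ NCStep x y) (insert Γ ρ) ρ := by
  induction n with
  | zero => intro Γ h; omega
  | succ n ih =>
    intro Γ hn hu ρ
    by_cases hr : ∃ F ∈ Γ, Red F
    · obtain ⟨F, hF, hR⟩ := hr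
      have hw := compWt_erase F Γ hF
      have he := Finset.insert_erase hF
      generalize Γ.erase F = Δ at hw he
      subst he
      match F, hR with
      | .conj A B, _ =>
        refine .head (Or.inl (GStep.conj Δ A B ρ)) (ih _ ?_ ?_ ρ)
        · have h1 := compWt_insert_le A (insert B Δ)
          have h2 := compWt_insert_le B Δ
          simp only [Fml.wt] at hw
          omega
        · rintro ⟨v, hv⟩
          exact hu ⟨v, by simp_all [Fml.eval]⟩
      | .disj A B, _ =>
        refine .head (Or.inl (GStep.disj Δ A B ρ)) (.trans (ih _ ?_ ?_ _) (ih _ ?_ ?_ _))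
        · have h1 := compWt_insert_le A Δ
          simp only [Fml.wt] at hw
          omega
        · rintro ⟨v, hv⟩
          exact hu ⟨v, by simp_all [Fml.eval]⟩
        · have h1 := compWt_insert_le B Δ
          simp only [Fml.wt] at hw
          omega
        · rintro ⟨v, hv⟩
          exact hu ⟨v, by simp_all [Fml.eval]⟩
      | .neg (.neg A), _ =>
        refine .head (Or.inl (GStep.negneg Δ A ρ)) (ih _ ?_ ?_ ρ)
        · have h1 := compWt_insert_le A Δ
          simp only [Fml.wt, Bool.not_true, Bool.not_false] at hw
          omega
        · rintro ⟨v, hv⟩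
          exact hu ⟨v, by simp_all [Fml.eval]⟩
      | .neg (.disj A B), _ =>
        refine .head (Or.inl (GStep.negdisj Δ A B ρ)) (ih _ ?_ ?_ ρ)
        · have h1 := compWt_insert_le (.neg A) (insert (.neg B) Δ)
          have h2 := compWt_insert_le (.neg B) Δ
          simp only [Fml.wt] at hw h1 h2
          omega
        · rintro ⟨v, hv⟩
          exact hu ⟨v, by simp_all [Fml.eval]⟩
      | .neg (.conj A B), _ =>
        refine .head (Or.inl (GStep.negconj Δ A B ρ)) (.trans (ih _ ?_ ?_ _) (ih _ ?_ ?_ _))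
        · have h1 := compWt_insert_le (.neg A) Δ
          simp only [Fml.wt] at hw h1
          omega
        · rintro ⟨v, hv⟩
          exact hu ⟨v, by simp_all [Fml.eval]⟩
        · have h1 := compWt_insert_le (.neg B) Δ
          simp only [Fml.wt] at hw h1
          omega
        · rintro ⟨v, hv⟩
          exact hu ⟨v, by simp_all [Fml.eval]⟩
    · by_cases hc : ∃ k, Fml.var k ∈ Γ ∧ Fml.neg (Fml.var k) ∈ Γ
      · obtain ⟨k, h1, h2⟩ := hc
        refine .single (Or.inr ⟨Γ, Fml.var k, ?_⟩)
        rw [Finset.insert_eq_of_mem h2, Finset.insert_eq_of_mem h1]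
      · exfalso
        refine hu ⟨fun k => decide (Fml.var k ∈ Γ), fun F hF => ?_⟩
        have hR : ¬ Red F := fun h => hr ⟨F, hF, h⟩
        match F, hR with
        | .var k, _ => simpa [Fml.eval] using hF
        | .neg (.var k), _ =>
          have : Fml.var k ∉ Γ := fun h => hc ⟨k, h, hF⟩
          simpa [Fml.eval] using this
        | .conj A B, h => exact absurd trivial h
        | .disj A B, h => exact absurd trivial h
        | .neg (.neg A), h => exact absurd trivial h
        | .neg (.conj A B), h => exact absurd trivial h
        | .neg (.disj A B), h => exact absurd trivial h

theorem datum_elim (α : Datum) : (¬ ∃ v : ℕ → Bool, Verifies v α) →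
    Relation.ReflTransGen (fun x y => GStep x y ∨ NCStep x y) α (∅ : Datum) := by
  induction α using Finset.induction_on with
  | empty => intro _; exact .refl
  | insert Γ ρ _ ih =>
    intro h
    refine .trans (comp_elim _ Γ (Nat.lt_succ_self _) ?_ ρ) (ih ?_)
    · rintro ⟨v, hv⟩
      exact h ⟨v, Γ, Finset.mem_insert_self _ _, hv⟩
    · rintro ⟨v, Δ, hΔ, hv⟩
      exact h ⟨v, Δ, Finset.mem_insert_of_mem hΔ, hv⟩

/-- Normal-refutation completeness of DC: every unsatisfiable datum has a
purely analytic refutation (a deduction of the empty datum ⊥ by analytic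
rules only); moreover it has one using only analytic G-rules and NC
(in particular without the analytic S-rule Del). -/
theorem dc_normal_refutation_completeness (α : Datum)
    (h : ¬ ∃ v : ℕ → Bool, Verifies v α) :
    Relation.ReflTransGen (fun x y => GStep x y ∨ NCStep x y ∨ DelStep x y)
      α (∅ : Datum) ∧
    Relation.ReflTransGen (fun x y => GStep x y ∨ NCStep x y)
      α (∅ : Datum) := by
  have h2 := datum_elim α h
  refine ⟨?_, h2⟩
  refine Relation.ReflTransGen.mono ?_ _ _ h2
  intro x y hxy
  rcases hxy with h | h
  · exact Or.inl h
  · exact Or.inr (Or.inl h)
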